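/- arXiv:1401.5665 — 3 statements merged into one kernel-verified Lean document; each statement's English description precedes it below -/
import Mathlib

section
/- For every total clone D on 𝟚 with D ⊆ T_{0,2}, the interval I_str(D) has the cardinality of the continuum (2^{ℵ₀}). -/
namespace StrongPartial

/-- Partial functions of arity `n+1` on `A` (arities are `≥ 1`).
`f.2 x = some a` means `x ∈ dom f` with value `a`; `f.2 x = none` means `x ∉ dom f`. -/
def PF (A : Type) : Type := Σ n : ℕ, (Fin (n+1) → A) → Option A

variable {A : Type}

/-- `f` is a total function. -/
def IsTotalPF (f : PF A) : Prop := ∀ x, (f.2 x).isSome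

/-- The set of all total functions on `A`. -/
def OSet (A : Type) : Set (PF A) := {f | IsTotalPF f}

/-- The `(n+1)`-ary projection onto the `i`-th coordinate. -/
def proj (n : ℕ) (i : Fin (n+1)) : PF A := ⟨n, fun x => some (x i)⟩

/-- Composition of an arity-`k` partial function with `k` partial functions of arity `m`. -/
def compFun {k m : ℕ} (f : (Fin k → A) → Option A) (g : Fin k → ((Fin m → A) → Option A)) :
    (Fin m → A) → Option A :=
  fun x => if h : ∀ i, (g i x).isSome then f (fun i => (g i x).get (h i)) else none

/-- A partial clone: contains all projections and is closed under composition. -/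
def IsPartialClone (X : Set (PF A)) : Prop :=
  (∀ (n : ℕ) (i : Fin (n+1)), proj n i ∈ X) ∧
  (∀ f ∈ X, ∀ (m : ℕ) (g : Fin (f.1+1) → ((Fin (m+1) → A) → Option A)),
     (∀ i, (⟨m, g i⟩ : PF A) ∈ X) → (⟨m, compFun f.2 g⟩ : PF A) ∈ X)

/-- A total clone: a partial clone consisting of total functions. -/
def IsClone (C : Set (PF A)) : Prop := IsPartialClone C ∧ C ⊆ OSet A

/-- `f ≤ g`: `f` is a restriction (subfunction) of `g`. -/
def PFle (f g : PF A) : Prop :=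
  ∃ h : f.1 = g.1, ∀ (x : Fin (f.1+1) → A) (a : A),
    f.2 x = some a → g.2 (fun i => x (Fin.cast (by rw [h]) i)) = some a

/-- `Str X`: all restrictions of members of `X`. -/
def StrSet (X : Set (PF A)) : Set (PF A) := {f | ∃ g ∈ X, PFle f g}

/-- `X` is strong (restriction closed). -/
def IsStrong (X : Set (PF A)) : Prop := StrSet X = X

/-- `f` preserves the `h`-ary relation `ρ`. -/
def Preserves (f : PF A) {h : ℕ} (ρ : Set (Fin h → A)) : Prop :=
  ∀ (M : Fin h → Fin (f.1+1) → A) (v : Fin h → A),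
    (∀ j, (fun i => M i j) ∈ ρ) → (∀ i, f.2 (M i) = some (v i)) → v ∈ ρ

def pPolSet {h : ℕ} (ρ : Set (Fin h → A)) : Set (PF A) := {f | Preserves f ρ}

def PolSet {h : ℕ} (ρ : Set (Fin h → A)) : Set (PF A) := pPolSet ρ ∩ OSet A

/-- `f` preserves the relation pair `(ρ, ρ')`. -/
def PreservesPair (f : PF A) {h : ℕ} (ρ ρ' : Set (Fin h → A)) : Prop :=
  ∀ (M : Fin h → Fin (f.1+1) → A) (v : Fin h → A),
    (∀ j, (fun i => M i j) ∈ ρ) → (∀ i, f.2 (M i) = some (v i)) → v ∈ ρ'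

def cPolSet {h : ℕ} (ρ ρ' : Set (Fin h → A)) : Set (PF A) := {f | PreservesPair f ρ ρ'}

/-- The interval `I_str(C)` of strong partial clones with total part `C`. -/
def Istr (C : Set (PF A)) : Set (Set (PF A)) :=
  {X | IsPartialClone X ∧ IsStrong X ∧ X ∩ OSet A = C}

/-! Maltsev operations -/

def zeta (f : PF A) : PF A := ⟨f.1, fun x => f.2 (fun i => x (i + 1))⟩

def tau (f : PF A) : PF A := ⟨f.1, fun x => f.2 (fun i => x (Equiv.swap 0 1 i))⟩

def nabla (f : PF A) : PF A := ⟨f.1 + 1, fun x => f.2 (fun i => x i.succ)⟩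

def delta (f : PF A) : PF A :=
  match f with
  | ⟨0, g⟩ => ⟨0, g⟩
  | ⟨n+1, g⟩ => ⟨n, fun x => g (fun i => x ⟨i.val - 1, by have := i.isLt; omega⟩)⟩

/-- `f ⋆ g`. -/
def starPF (f g : PF A) : PF A :=
  ⟨f.1 + g.1, fun x =>
    (g.2 (fun j => x ⟨j.val, by have := j.isLt; omega⟩)).bind
      (fun a => f.2 (fun i =>
        if i.val = 0 then a else x ⟨g.1 + i.val, by have := i.isLt; omega⟩))⟩

/-- A partial class: closed under `ζ`, `τ`, `Δ`, `∇` and `⋆`. -/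
def IsPartialClass (X : Set (PF A)) : Prop :=
  (∀ f ∈ X, zeta f ∈ X) ∧ (∀ f ∈ X, tau f ∈ X) ∧ (∀ f ∈ X, delta f ∈ X) ∧
  (∀ f ∈ X, nabla f ∈ X) ∧ (∀ f ∈ X, ∀ g ∈ X, starPF f g ∈ X)

def starSet (X Y : Set (PF A)) : Set (PF A) := {h | ∃ f ∈ X, ∃ g ∈ Y, h = starPF f g}

/-- The constant function of arity `n+1` with value `a`. -/
def constPF (a : A) (n : ℕ) : PF A := ⟨n, fun _ => some a⟩

/-- The total clone generated by a set `G` of total functions. -/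
def cloneGen (G : Set (PF A)) : Set (PF A) := ⋂₀ {C | IsClone C ∧ G ⊆ C}


/-! Boolean-specific definitions (`0 = false`, `1 = true`). -/

/-- `T_0 = Pol {(0)}`. -/
def relT0 : Set (Fin 1 → Bool) := {fun _ => false}

/-- `T_1 = Pol {(1)}`. -/
def relT1 : Set (Fin 1 → Bool) := {fun _ => true}

/-- `{(0,0),(0,1),(1,1)}`, defining the monotone functions. -/
def relM : Set (Fin 2 → Bool) := {![false, false], ![false, true], ![true, true]}

/-- `{(0,1),(1,0)}`, defining the self-dual functions. -/
def relS : Set (Fin 2 → Bool) := {![false, true], ![true, false]}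

/-- `{(x,x,y,y),(x,y,x,y),(x,y,y,x) : x,y ∈ 𝟚}`, defining the linear functions. -/
def relL : Set (Fin 4 → Bool) :=
  {v | ∃ x y : Bool, v = ![x, x, y, y] ∨ v = ![x, y, x, y] ∨ v = ![x, y, y, x]}

def T0 : Set (PF Bool) := PolSet relT0
def T1 : Set (PF Bool) := PolSet relT1
def Mclone : Set (PF Bool) := PolSet relM
def Sclone : Set (PF Bool) := PolSet relS
def Lclone : Set (PF Bool) := PolSet relL

/-- `ρ_{0,2} = {(0,0),(0,1),(1,0)}`. -/
def rel02 : Set (Fin 2 → Bool) := {![false, false], ![false, true], ![true, false]}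

/-- `T_{0,2} = Pol ρ_{0,2}`. -/
def T02 : Set (PF Bool) := PolSet rel02

/-- Cyclic successor on `Fin n`. -/
def cyc {n : ℕ} (i : Fin n) : Fin n := ⟨(i.val + 1) % n, Nat.mod_lt _ (by have := i.isLt; omega)⟩

/-- `R^{0,2}_{C,n}`: the cyclic-graph relation. -/
def RC (n : ℕ) : Set (Fin n → Bool) := {x | ∀ i : Fin n, ![x i, x (cyc i)] ∈ rel02}

/-- `R^{0,2}_{K,n}`: the complete-graph relation. -/
def RK (n : ℕ) : Set (Fin n → Bool) := {x | ∀ i j : Fin n, i ≠ j → ![x i, x j] ∈ rel02}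

/-- `R^{0,2}_n := R^{0,2}_{C,n} × R^{0,2}_{K,n} ⊆ 𝟚^{2n}`. -/
def R02 (n : ℕ) : Set (Fin (n + n) → Bool) :=
  {x | (fun i => x (Fin.castAdd n i)) ∈ RC n ∧ (fun i => x (Fin.natAdd n i)) ∈ RK n}

/-- The binary conjunction as a partial (total) function. -/
def andPF : PF Bool := ⟨1, fun x => some (x 0 && x 1)⟩

/-- The constant Boolean functions `c_0, c_1` of all arities. -/
def constantsBool : Set (PF Bool) :=
  {f | ∃ n : ℕ, f = constPF false n ∨ f = constPF true n}

/-- `C_{01}`: the clone generated by the constants `c_0, c_1`. -/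
def C01 : Set (PF Bool) := cloneGen constantsBool

/-- `Λ`: the clone generated by `∧, c_0, c_1`. -/
def LambdaClone : Set (PF Bool) := cloneGen (insert andPF constantsBool)

/-- The monster relation `R^Λ_m ⊆ 𝟚^{m+1}` (coordinates 0-indexed: index 0 is the paper's 1). -/
def RLam (m : ℕ) : Set (Fin (m+1) → Bool) :=
  {x | (x 0 = true ∨ ∃ j : Fin (m+1), j ≠ 0 ∧ x j = false) ∧
       ∀ i j1 j2 : Fin (m+1), i ≠ 0 → j1 ≠ 0 → j2 ≠ 0 → i ≠ j1 → i ≠ j2 → j1 ≠ j2 →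
         (x i = true ∨ x 0 = false ∨ x j1 = false ∨ x j2 = false)}

/-- `n(k,p) := (2k−1)p + 1`. -/
def nkp (k p : ℕ) : ℕ := (2 * k - 1) * p + 1

/-- The `n(k,p)`-ary partial function `τ_p^k`. -/
def tauPF (k p : ℕ) : PF Bool :=
  ⟨nkp k p - 1, fun x =>
    if ∀ i, x i = true then some true
    else if (Finset.univ.filter (fun i => x i = true)).card ≤ p then some false
    else none⟩

/-- `p_1 := 1`, `p_j := n(j, p_{j−1})` for `j ≥ 2`. -/
def pseq : ℕ → ℕ
  | 0 => 1
  | 1 => 1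
  | (j+2) => nkp (j+2) (pseq (j+1))

/-- `ξ_j := τ^{j+1}_{p_j}`. -/
def xi (j : ℕ) : PF Bool := tauPF (j + 1) (pseq j)

/-- `ρ_C = {(0,0,0,0),(0,0,1,1),(0,1,0,1),(1,1,1,1)}`. -/
def rhoC : Set (Fin 4 → Bool) :=
  {![false, false, false, false], ![false, false, true, true],
   ![false, true, false, true], ![true, true, true, true]}

/-- `ρ_1 = ρ_C ∪ {(1,0,1,0),(1,1,0,0)}`. -/
def rho1 : Set (Fin 4 → Bool) :=
  rhoC ∪ {![true, false, true, false], ![true, true, false, false]}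

/-- `f_a`: extension of `f` fixing the new first coordinate to `a`. -/
def extConst {A : Type} [DecidableEq A] (a : A) (f : PF A) : PF A :=
  ⟨f.1 + 1, fun x => if x 0 = a then f.2 (fun i => x i.succ) else none⟩



/-! Auxiliary material for the proof. -/

/-- Vertices of the disjoint union of an odd cycle and a clique. -/
abbrev VV (n : ℕ) : Type := ZMod (2*n+5) ⊕ Fin (2*n+5)

def EE (n : ℕ) : VV n → VV n → Prop
  | Sum.inl a, Sum.inl b => b = a + 1 ∨ a = b + 1
  | Sum.inr a, Sum.inr b => a ≠ b
  | _, _ => False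

lemma EE_symm {n : ℕ} {x y : VV n} (h : EE n x y) : EE n y x := by
  rcases x with a | a <;> rcases y with b | b <;> simp only [EE] at h ⊢
  · tauto
  · exact h.symm

lemma small_ne (n : ℕ) (k : ℤ) (h0 : k ≠ 0) (h1 : |k| ≤ 2*n+4) : (k : ZMod (2*n+5)) ≠ 0 := by
  intro h
  rw [ZMod.intCast_zmod_eq_zero_iff_dvd] at h
  have := Int.le_of_dvd (abs_pos.mpr h0) ((dvd_abs _ _).mpr h)
  push_cast at this
  omega

lemma EE_irrefl {n : ℕ} (x : VV n) : ¬ EE n x x := by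
  have h1 := small_ne n 1 (by norm_num) (by norm_num; omega)
  push_cast at h1
  rcases x with a | a <;> simp only [EE]
  · intro h
    have h : a + 1 = a := by rcases h with h | h <;> exact h.symm
    exact h1 (by simpa using h)
  · simp

lemma no_tri {n : ℕ} (a b c : ZMod (2*n+5)) (h1 : EE n (Sum.inl a) (Sum.inl b))
    (h2 : EE n (Sum.inl b) (Sum.inl c)) (h3 : EE n (Sum.inl c) (Sum.inl a)) : False := by
  have k1 := small_ne n 1 (by norm_num) (by norm_num; omega)
  have k3 := small_ne n 3 (by norm_num) (by norm_num; omega)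
  push_cast at k1 k3
  simp only [EE] at h1 h2 h3
  rcases h1 with h1 | h1 <;> rcases h2 with h2 | h2 <;> rcases h3 with h3 | h3
  · exact k3 (by linear_combination -h1 - h2 - h3)
  · exact k1 (by linear_combination -h1 - h2 + h3)
  · exact k1 (by linear_combination -h1 + h2 - h3)
  · exact k1 (by linear_combination h1 - h2 - h3)
  · exact k1 (by linear_combination h1 - h2 - h3)
  · exact k1 (by linear_combination -h1 + h2 - h3)
  · exact k1 (by linear_combination -h1 - h2 + h3)
  · exact k3 (by linear_combination -h1 - h2 - h3)

lemma cyc_hom {m n : ℕ} (h : ZMod (2*m+5) → ZMod (2*n+5))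
    (hh : ∀ i, EE n (Sum.inl (h i)) (Sum.inl (h (i+1)))) : n ≤ m := by
  have : ∀ i, ∃ s : ℤ, (s = 1 ∨ s = -1) ∧ h (i+1) - h i = (s : ZMod (2*n+5)) := by
    intro i
    rcases hh i with h1 | h1
    · exact ⟨1, Or.inl rfl, by rw [h1]; push_cast; ring⟩
    · exact ⟨-1, Or.inr rfl, by push_cast; linear_combination -h1⟩
  choose s hs1 hs2 using this
  have hsum : ((∑ i, s i : ℤ) : ZMod (2*n+5)) = 0 := by
    push_cast
    rw [← Finset.sum_congr rfl (fun i _ => hs2 i), Finset.sum_sub_distrib, sub_eq_zero]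
    exact Equiv.sum_comp (Equiv.addRight (1 : ZMod (2*m+5))) h
  rw [ZMod.intCast_zmod_eq_zero_iff_dvd] at hsum
  have habs : |∑ i, s i| ≤ 2*m+5 := by
    refine (Finset.abs_sum_le_sum_abs _ _).trans ?_
    have : ∀ i ∈ (Finset.univ : Finset (ZMod (2*m+5))), |s i| = 1 := by
      intro i _
      rcases hs1 i with h | h <;> rw [h] <;> norm_num
    rw [Finset.sum_congr rfl this]
    simp [ZMod.card]
  have hodd : ((∑ i, s i : ℤ) : ZMod 2) = 1 := by
    push_cast
    have : ∀ i ∈ (Finset.univ : Finset (ZMod (2*m+5))), ((s i : ℤ) : ZMod 2) = 1 := by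
      intro i _
      rcases hs1 i with h | h <;> rw [h] <;> decide
    rw [Finset.sum_congr rfl this]
    simp only [Finset.sum_const, Finset.card_univ, ZMod.card, nsmul_eq_mul, mul_one]
    push_cast
    have : (2 : ZMod 2) = 0 := by decide
    rw [this]
    simp
    decide
  have hne : (∑ i, s i) ≠ 0 := by
    intro h
    rw [h] at hodd
    revert hodd
    decide
  have := Int.le_of_dvd (abs_pos.mpr hne) ((dvd_abs _ _).mpr hsum)
  push_cast at this
  omega

lemma EE_left {n : ℕ} {x y : VV n} (h : EE n x y) (hx : x.isLeft) : y.isLeft := by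
  rcases x with a | a <;> rcases y with b | b <;> simp_all [EE]

lemma clique_right {m n : ℕ} (h : VV m → VV n)
    (hh : ∀ x y, EE m x y → EE n (h x) (h y)) (a : Fin (2*m+5)) : ¬ (h (Sum.inr a)).isLeft := by
  intro ha
  obtain ⟨b, hb⟩ : ∃ b : Fin (2*m+5), b ≠ a := exists_ne a
  obtain ⟨c, hc⟩ : ∃ c : Fin (2*m+5), c ∉ ({a, b} : Finset (Fin (2*m+5))) := by
    by_contra hcon
    push Not at hcon
    have := Finset.card_le_card (fun x _ => hcon x : (Finset.univ : Finset _) ⊆ {a, b})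
    have h2 := Finset.card_le_two (a := a) (b := b)
    simp at this
    omega
  simp only [Finset.mem_insert, Finset.mem_singleton, not_or] at hc
  have h1 := hh (Sum.inr a) (Sum.inr b) hb.symm
  have h2 := hh (Sum.inr b) (Sum.inr c) (Ne.symm hc.2)
  have h3 := hh (Sum.inr c) (Sum.inr a) hc.1
  have hb := EE_left h1 ha
  have hc := EE_left h2 hb
  obtain ⟨a', ha'⟩ := Sum.isLeft_iff.mp ha
  obtain ⟨b', hb'⟩ := Sum.isLeft_iff.mp hb
  obtain ⟨c', hc'⟩ := Sum.isLeft_iff.mp hc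
  rw [ha', hb'] at h1
  rw [hb', hc'] at h2
  rw [hc', ha'] at h3
  exact no_tri _ _ _ h1 h2 h3

lemma hom_comb {m n : ℕ} (hmn : m ≠ n) (h : VV m → VV n)
    (hh : ∀ x y, EE m x y → EE n (h x) (h y)) (x : VV m) : ¬ (h x).isLeft := by
  rcases x with i | a
  swap
  · exact clique_right h hh a
  intro hi
  have hstep : ∀ k : ℕ, (h (Sum.inl (i + k))).isLeft := by
    intro k
    induction k with
    | zero => simpa using hi
    | succ k ih =>
      refine EE_left (hh _ _ ?_) ih
      left
      push_cast
      ring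
  have hall : ∀ j, ∃ b, h (Sum.inl j) = Sum.inl b := by
    intro j
    rw [← Sum.isLeft_iff]
    have := hstep (j - i).val
    rw [ZMod.natCast_zmod_val] at this
    simpa using this
  choose g hg using hall
  have h1 : n ≤ m := by
    refine cyc_hom g ?_
    intro j
    have := hh (Sum.inl j) (Sum.inl (j+1)) (Or.inl rfl)
    rwa [hg, hg] at this
  have hall : ∀ j, ∃ b, h (Sum.inr j) = Sum.inr b := by
    intro j
    have := clique_right h hh j
    rw [← Sum.isRight_iff]
    simpa using this
  choose r hr using hall
  have hinj : Function.Injective r := by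
    intro a b hab
    by_contra hne
    have := hh (Sum.inr a) (Sum.inr b) hne
    rw [hr, hr] at this
    exact this hab
  have := Fintype.card_le_of_injective r hinj
  simp at this
  omega

def Disj {k : ℕ} (x y : Fin k → Bool) : Prop := ∀ i, ¬ (x i = true ∧ y i = true)

def Pres (n : ℕ) (f : PF Bool) : Prop :=
  ∀ (φ : VV n → Fin (f.1+1) → Bool) (v : VV n → Bool),
    (∀ x, f.2 (φ x) = some (v x)) → (∀ x y, EE n x y → Disj (φ x) (φ y)) →
    ∀ x y, EE n x y → ¬ (v x = true ∧ v y = true)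

open Classical in
lemma exists_sep (n : ℕ) : ∃ f : PF Bool, f.2 (fun _ => false) = none ∧ ¬ Pres n f ∧
    ∀ m, m ≠ n → Pres m f := by
  obtain ⟨k, ⟨e⟩⟩ : ∃ k, Nonempty (Fin (k+1) ≃ VV n × VV n) := by
    refine ⟨Fintype.card (VV n × VV n) - 1, ⟨(Fintype.equivFinOfCardEq ?_).symm⟩⟩
    have : 0 < Fintype.card (VV n × VV n) := Fintype.card_pos
    omega
  let code : VV n → Fin (k+1) → Bool := fun x p =>
    decide ((x = (e p).1 ∨ x = (e p).2) ∧ ¬ EE n (e p).1 (e p).2)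
  have hself : ∀ x, code x (e.symm (x,x)) = true := by
    intro x
    simp [code, EE_irrefl]
  have hinj : Function.Injective code := by
    intro x y hxy
    have := hself x
    rw [hxy] at this
    simp [code] at this
    exact this.1.symm
  have hdisj : ∀ x y, Disj (code x) (code y) ↔ EE n x y := by
    intro x y
    constructor
    · intro h
      by_contra hne
      apply h (e.symm (x,y))
      simp [code, hne]
    · intro h p hp
      simp only [code, decide_eq_true_eq] at hp
      obtain ⟨⟨h1, h2⟩, h3, -⟩ := hp
      rcases h1 with h1 | h1 <;> rcases h3 with h3 | h3
      · rw [h1, h3] at h; exact EE_irrefl _ h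
      · rw [h1, h3] at h; exact h2 h
      · rw [h1, h3] at h; exact h2 (EE_symm h)
      · rw [h1, h3] at h; exact EE_irrefl _ h
  let F : (Fin (k+1) → Bool) → Option Bool := fun z =>
    if h : ∃ x, code x = z then some (h.choose.isLeft) else none
  have hF : ∀ z a, F z = some a → ∃ x, code x = z ∧ a = x.isLeft := by
    intro z a h
    by_cases hz : ∃ x, code x = z
    · simp only [F, dif_pos hz, Option.some.injEq] at h
      exact ⟨hz.choose, hz.choose_spec, h.symm⟩
    · simp only [F, dif_neg hz] at h; cases h
  have hF2 : ∀ x, F (code x) = some x.isLeft := by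
    intro x
    have hz : ∃ y, code y = code x := ⟨x, rfl⟩
    simp only [F, dif_pos hz]
    rw [hinj hz.choose_spec]
  refine ⟨⟨k, F⟩, ?_, ?_, ?_⟩
  · cases h : F (fun _ => false) with
    | none => exact h
    | some a =>
      obtain ⟨x, hx, -⟩ := hF _ _ h
      have := hself x
      rw [hx] at this
      simp at this
  · intro h
    exact h code (fun x => x.isLeft) hF2 (fun x y hxy => (hdisj x y).2 hxy)
      (Sum.inl 0) (Sum.inl (0+1)) (Or.inl rfl) ⟨rfl, rfl⟩
  · intro m hm φ v hv hd x y hxy hcon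
    choose h hh1 hh2 using fun x => hF _ _ (hv x)
    refine hom_comb hm h ?_ x ?_
    · intro a b hab
      rw [← hdisj, hh1, hh1]
      exact hd a b hab
    · rw [← hh2]; exact hcon.1

lemma compFun_eq_some {k m : ℕ} (f : (Fin k → A) → Option A)
    (g : Fin k → ((Fin m → A) → Option A)) (x : Fin m → A) (a : A) :
    compFun f g x = some a ↔ ∃ y, (∀ i, g i x = some (y i)) ∧ f y = some a := by
  constructor
  · intro h
    unfold compFun at h
    split_ifs at h with hh
    exact ⟨_, fun i => (Option.some_get (hh i)).symm, h⟩
  · rintro ⟨y, hy, hf⟩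
    have hh : ∀ i, (g i x).isSome := fun i => by simp [hy i]
    unfold compFun
    rw [dif_pos hh, ← hf]
    congr 1
    funext i
    simp [hy i]

lemma mem_Str (X : Set (PF A)) (f : PF A) : f ∈ StrSet X ↔
    ∃ g : (Fin (f.1+1) → A) → Option A, (⟨f.1, g⟩ : PF A) ∈ X ∧
      ∀ x a, f.2 x = some a → g x = some a := by
  obtain ⟨n, f⟩ := f
  constructor
  · rintro ⟨⟨n', g⟩, hg, h, hh⟩
    dsimp only at h
    subst h
    exact ⟨g, hg, hh⟩
  · rintro ⟨g, hg, hh⟩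
    exact ⟨⟨n, g⟩, hg, rfl, hh⟩

lemma T02_disj {f : PF Bool} (hf : f ∈ T02) {x y : Fin (f.1+1) → Bool} {a b : Bool}
    (hd : Disj x y) (ha : f.2 x = some a) (hb : f.2 y = some b) : ¬ (a = true ∧ b = true) := by
  have h := hf.1 ![x, y] ![a, b] ?_ ?_
  · rintro ⟨rfl, rfl⟩
    simp only [rel02, Set.mem_insert_iff, Set.mem_singleton_iff] at h
    rcases h with h | h | h
    · have := congrFun h 0; simp at this
    · have := congrFun h 0; simp at this
    · have := congrFun h 1; simp at this
  · intro j
    have hj := hd j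
    have : (fun i => (![x, y] : Fin 2 → Fin (f.1+1) → Bool) i j) = ![x j, y j] := by
      funext i; fin_cases i <;> rfl
    rw [this]
    simp only [rel02, Set.mem_insert_iff, Set.mem_singleton_iff]
    cases hx : x j <;> cases hy : y j <;> simp_all
  · intro i
    fin_cases i
    · exact ha
    · exact hb

lemma Str_Pres {D : Set (PF Bool)} (hDT : D ⊆ T02) {f : PF Bool} (hf : f ∈ StrSet D) (n : ℕ) :
    Pres n f := by
  obtain ⟨g, hg, hle⟩ := (mem_Str D f).1 hf
  intro φ v hv hd x y hxy
  exact T02_disj (hDT hg) (hd x y hxy) (hle _ _ (hv x)) (hle _ _ (hv y))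

lemma Str_zero {D : Set (PF Bool)} (hDT : D ⊆ T02) {f : PF Bool} (hf : f ∈ StrSet D) (a : Bool)
    (ha : f.2 (fun _ => false) = some a) : a = false := by
  obtain ⟨g, hg, hle⟩ := (mem_Str D f).1 hf
  have := T02_disj (hDT hg) (x := fun _ => false) (y := fun _ => false) (by intro i; simp)
    (hle _ _ ha) (hle _ _ ha)
  simpa using this

def YY (S : Set ℕ) : Set (PF Bool) :=
  {f | f.2 (fun _ => false) = none ∧ ∀ n ∈ S, Pres n f}

lemma YY_mem_Istr (D : Set (PF Bool)) (hD : IsClone D)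
    (hDT : D ⊆ T02) (S : Set ℕ) : StrSet D ∪ YY S ∈ Istr D := by
  have hDS : D ⊆ StrSet D := fun f hf => (mem_Str D f).2 ⟨f.2, hf, fun _ _ h => h⟩
  have hP : ∀ f ∈ StrSet D ∪ YY S, ∀ n ∈ S, Pres n f := by
    rintro f (hf | hf) n hn
    · exact Str_Pres hDT hf n
    · exact hf.2 n hn
  refine ⟨⟨fun n i => Or.inl (hDS (hD.1.1 n i)), ?_⟩, ?_, ?_⟩
  · intro f hf m g hg
    by_cases hall : f ∈ StrSet D ∧ ∀ i, (⟨m, g i⟩ : PF Bool) ∈ StrSet D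
    · left
      obtain ⟨hf, hg⟩ := hall
      obtain ⟨f', hf', hfle⟩ := (mem_Str D f).1 hf
      choose g' hg' hgle using fun i => (mem_Str D _).1 (hg i)
      refine (mem_Str D _).2 ⟨compFun f' g', hD.1.2 ⟨f.1, f'⟩ hf' m g' hg', ?_⟩
      intro x a hx
      obtain ⟨y, hy, hfy⟩ := (compFun_eq_some _ _ _ _).1 hx
      exact (compFun_eq_some _ _ _ _).2 ⟨y, fun i => hgle i _ _ (hy i), hfle _ _ hfy⟩
    · right
      refine ⟨?_, ?_⟩
      · rw [Option.eq_none_iff_forall_ne_some]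
        intro a ha
        obtain ⟨y, hy, hfy⟩ := (compFun_eq_some _ _ _ _).1 ha
        have hgD : ∀ i, (⟨m, g i⟩ : PF Bool) ∈ StrSet D := by
          intro i
          rcases hg i with h | h
          · exact h
          · have h1 := h.1
            have h2 := hy i
            dsimp only at h1
            rw [h1] at h2
            simp at h2
        have hfD : f ∈ StrSet D := by
          rcases hf with h | h
          · exact h
          · have : y = fun _ => false := by
              funext i
              exact Str_zero hDT (hgD i) _ (hy i)
            rw [this, h.1] at hfy
            simp at hfy
        exact hall ⟨hfD, hgD⟩
      · intro n hn φ v hv hd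
        choose y hy hfy using fun x => (compFun_eq_some _ _ _ _).1 (hv x)
        refine hP f hf n hn y v hfy ?_
        intro a b hab i
        exact hP _ (hg i) n hn φ (fun x => y x i) (fun x => hy x i) hd a b hab
  · refine Set.Subset.antisymm ?_ (fun f hf => (mem_Str _ f).2 ⟨f.2, hf, fun _ _ h => h⟩)
    intro f hf
    obtain ⟨g, hg, hle⟩ := (mem_Str _ f).1 hf
    rcases hg with hg | hg
    · left
      obtain ⟨g', hg', hle'⟩ := (mem_Str _ _).1 hg
      exact (mem_Str _ f).2 ⟨g', hg', fun x a h => hle' _ _ (hle _ _ h)⟩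
    · right
      refine ⟨?_, ?_⟩
      · rw [Option.eq_none_iff_forall_ne_some]
        intro a ha
        have h1 := hle _ _ ha
        have h2 := hg.1
        dsimp only at h2
        rw [h2] at h1
        simp at h1
      · intro n hn φ v hv hd
        exact hg.2 n hn φ v (fun x => hle _ _ (hv x)) hd
  · refine Set.Subset.antisymm ?_ (fun f hf => ⟨Or.inl (hDS hf), hD.2 hf⟩)
    rintro f ⟨hf | hf, ht⟩
    · obtain ⟨g, hg, hle⟩ := (mem_Str _ f).1 hf
      have : f.2 = g := by
        funext x
        obtain ⟨a, ha⟩ := Option.isSome_iff_exists.1 (ht x)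
        rw [ha, hle _ _ ha]
      rw [← this] at hg
      exact hg
    · have h1 := ht (fun _ => false)
      rw [hf.1] at h1
      simp at h1

lemma YY_inj (D : Set (PF Bool)) (hDT : D ⊆ T02) :
    Function.Injective (fun S : Set ℕ => StrSet D ∪ YY S) := by
  have key : ∀ (S : Set ℕ) (n : ℕ), n ∈ S ↔ (exists_sep n).choose ∉ StrSet D ∪ YY S := by
    intro S n
    obtain ⟨h1, h2, h3⟩ := (exists_sep n).choose_spec
    constructor
    · rintro hn (h | h)
      · exact h2 (Str_Pres hDT h n)
      · exact h2 (h.2 n hn)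
    · intro h
      by_contra hn
      exact h (Or.inr ⟨h1, fun m hm => h3 m (fun e => hn (e ▸ hm))⟩)
  intro S T hST
  ext n
  rw [key S, key T]
  dsimp only at hST
  rw [hST]

theorem Istr_subclone_of_T02_continuum (D : Set (PF Bool)) (hD : IsClone D)
    (hDT : D ⊆ T02) : Cardinal.mk ↥(Istr D) = Cardinal.continuum := by
  apply le_antisymm
  · refine (Cardinal.mk_set_le _).trans ?_
    rw [Cardinal.mk_set, ← Cardinal.two_power_aleph0]
    have : Countable (PF Bool) := by unfold PF; infer_instance
    exact Cardinal.power_le_power_left two_ne_zero (Cardinal.mk_le_aleph0)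
  · rw [← Cardinal.two_power_aleph0, ← Cardinal.mk_nat, ← Cardinal.mk_set]
    refine Cardinal.mk_le_of_injective
      (f := fun S : Set ℕ => (⟨StrSet D ∪ YY S, YY_mem_Istr D hD hDT S⟩ : Istr D)) ?_
    intro S T h
    exact YY_inj D hDT (congrArg Subtype.val h)

end StrongPartial
end

section
/- For every m ≥ 3: Pol R^Λ_m = Λ, i.e. the set of total Boolean functions preserving the (m+1)-ary relation R^Λ_m is exactly the clone Λ. -/
namespace StrongPartial

variable {A : Type}

theorem preserves_compFun {h : ℕ} (ρ : Set (Fin h → A)) (f : PF A) (hf : Preserves f ρ) (m : ℕ)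
    (g : Fin (f.1+1) → ((Fin (m+1) → A) → Option A))
    (hg : ∀ i, Preserves (⟨m, g i⟩ : PF A) ρ) : Preserves (⟨m, compFun f.2 g⟩ : PF A) ρ := by
  intro M v hM hv
  have hs : ∀ i j, (g j (M i)).isSome := by
    intro i
    by_contra hc
    have := hv i
    simp only [compFun] at this
    rw [dif_neg hc] at this
    cases this
  apply hf (fun i j => (g j (M i)).get (hs i j)) v
  · intro j
    apply hg j M _ hM
    intro i
    simp
  · intro i
    have := hv i
    simp only [compFun] at this
    rw [dif_pos (hs i)] at this
    exact this

theorem isClone_PolSet {h : ℕ} (ρ : Set (Fin h → A)) : IsClone (PolSet ρ) := by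
  refine ⟨⟨?_, ?_⟩, fun f hf => hf.2⟩
  · intro n i
    refine ⟨?_, fun x => rfl⟩
    intro M v hM hv
    have : v = fun k => M k i := by
      funext k
      have := hv k
      simp only [proj, Option.some.injEq] at this
      exact this.symm
    rw [this]
    exact hM i
  · intro f hf m g hg
    refine ⟨preserves_compFun ρ f hf.1 m g (fun i => (hg i).1), ?_⟩
    intro x
    have hs : ∀ i, (g i x).isSome := fun i => (hg i).2 x
    simp only [compFun]
    rw [dif_pos hs]
    exact hf.2 _

theorem gens_sub (m : ℕ) (hm : 3 ≤ m) : insert andPF constantsBool ⊆ PolSet (RLam m) := by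
  rintro f (rfl | ⟨n, rfl | rfl⟩)
  · refine ⟨?_, fun x => rfl⟩
    intro M v hM hv
    have hv' : ∀ i, v i = (M i 0 && M i 1) := by
      intro i
      have := hv i
      simp only [andPF, Option.some.injEq] at this
      exact this.symm
    have h0 := hM 0
    have h1 := hM 1
    simp only [RLam, Set.mem_ofPred_eq] at h0 h1 ⊢
    simp only [hv']
    obtain ⟨a0, b0⟩ := h0
    obtain ⟨a1, b1⟩ := h1
    constructor
    · rcases a0 with a0 | ⟨j, hj, a0⟩
      · rcases a1 with a1 | ⟨j, hj, a1⟩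
        · left; simp [a0, a1]
        · right; exact ⟨j, hj, by simp [a1]⟩
      · right; exact ⟨j, hj, by simp [a0]⟩
    · intro i j1 j2 q1 q2 q3 q4 q5 q6
      have := b0 i j1 j2 q1 q2 q3 q4 q5 q6
      have := b1 i j1 j2 q1 q2 q3 q4 q5 q6
      grind
  · refine ⟨?_, fun x => rfl⟩
    intro M v hM hv
    have hv' : ∀ i, v i = false := by
      intro i
      have := hv i
      simp only [constPF, Option.some.injEq] at this
      exact this.symm
    refine ⟨Or.inr ⟨⟨1, by omega⟩, ?_, hv' _⟩, ?_⟩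
    · simp [Fin.ext_iff]
    · intros; exact Or.inr (Or.inl (hv' _))
  · refine ⟨?_, fun x => rfl⟩
    intro M v hM hv
    have hv' : ∀ i, v i = true := by
      intro i
      have := hv i
      simp only [constPF, Option.some.injEq] at this
      exact this.symm
    exact ⟨Or.inl (hv' _), by intros; exact Or.inl (hv' _)⟩

theorem mem_congr {C : Set (PF Bool)} {n : ℕ} {f g : (Fin (n+1) → Bool) → Option Bool}
    (h : f = g) (hf : (⟨n, f⟩ : PF Bool) ∈ C) : (⟨n, g⟩ : PF Bool) ∈ C := h ▸ hf

theorem and_mem (C : Set (PF Bool)) (hC : IsClone C) (hG : insert andPF constantsBool ⊆ C)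
    (n : ℕ) (p q : (Fin (n+1) → Bool) → Bool)
    (hp : (⟨n, fun x => some (p x)⟩ : PF Bool) ∈ C)
    (hq : (⟨n, fun x => some (q x)⟩ : PF Bool) ∈ C) :
    (⟨n, fun x => some (p x && q x)⟩ : PF Bool) ∈ C := by
  have h1 : ∀ i : Fin 2, (⟨n, (![fun x => some (p x), fun x => some (q x)] :
      Fin 2 → (Fin (n+1) → Bool) → Option Bool) i⟩ : PF Bool) ∈ C := by
    intro i
    match i with
    | 0 => exact hp
    | 1 => exact hq
  have := hC.1.2 andPF (hG (Or.inl rfl)) n _ h1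
  refine mem_congr ?_ this
  funext x
  have hs : ∀ i : Fin 2, ((![fun x => some (p x), fun x => some (q x)] :
      Fin 2 → (Fin (n+1) → Bool) → Option Bool) i x).isSome := by
    intro i
    match i with
    | 0 => rfl
    | 1 => rfl
  exact dif_pos hs

theorem conj_mem (C : Set (PF Bool)) (hC : IsClone C) (hG : insert andPF constantsBool ⊆ C)
    (n : ℕ) (S : Finset (Fin (n+1))) :
    (⟨n, fun x => some (decide (∀ i ∈ S, x i = true))⟩ : PF Bool) ∈ C := by
  induction S using Finset.induction_on with
  | empty =>
    have : (⟨n, fun x => some (decide (∀ i ∈ (∅ : Finset (Fin (n+1))), x i = true))⟩ : PF Bool)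
        = constPF true n := by simp [constPF]
    rw [this]
    exact hG (Or.inr ⟨n, Or.inr rfl⟩)
  | insert a S ha ih =>
    refine mem_congr ?_ (and_mem C hC hG n _ _ (hC.1.1 n a) ih)
    funext x
    simp

theorem Pol_RLam_eq_Lambda (m : ℕ) (hm : 3 ≤ m) : PolSet (RLam m) = LambdaClone := by
  apply Set.Subset.antisymm
  · intro f hf
    obtain ⟨hp, ht⟩ := hf
    rintro C ⟨hC, hG⟩
    obtain ⟨n, f⟩ := f
    obtain ⟨F, hF⟩ : ∃ F : (Fin (n+1) → Bool) → Bool, ∀ x, f x = some (F x) :=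
      ⟨fun x => (f x).get (ht x), fun x => by simp⟩
    have key : ∀ M : Fin (m+1) → Fin (n+1) → Bool, (∀ j, (fun i => M i j) ∈ RLam m) →
        (fun i => F (M i)) ∈ RLam m := fun M hM => hp M _ hM (fun i => hF _)
    have mono : ∀ a b : Fin (n+1) → Bool, (∀ j, a j = true → b j = true) →
        F a = true → F b = true := by
      intro a b hab hFa
      have h := key (fun i => if i = 0 then b else a) (by
        intro j
        have := hab j
        constructor
        · cases hj : b j
          · right
            refine ⟨⟨1, by omega⟩, by simp [Fin.ext_iff], ?_⟩
            show (if (⟨1, by omega⟩ : Fin (m+1)) = 0 then b else a) j = false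
            rw [if_neg (by simp [Fin.ext_iff])]
            cases ha : a j
            · rfl
            · simp [hj, ha] at this
          · left; simp [hj]
        · intro i j1 j2 q1 q2 q3 _ _ _
          simp only [if_neg q1, if_neg q2]
          cases a j <;> simp)
      rcases h.1 with h | ⟨j, hj, h⟩
      · simpa using h
      · simp [hj, hFa] at h
    have meet : ∀ a b : Fin (n+1) → Bool, F a = true → F b = true →
        F (fun j => a j && b j) = true := by
      intro a b hFa hFb
      have h := key (fun i => if i.val = 0 then (fun j => a j || b j) else if i.val = 1 then a
        else if i.val = 2 then b else (fun j => a j && b j)) (by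
        intro j
        constructor
        · cases ha : a j
          · right
            exact ⟨⟨1, by omega⟩, by simp [Fin.ext_iff], by simp [ha]⟩
          · left; simp [ha]
        · intro i j1 j2 q1 q2 q3 q4 q5 q6
          simp only [ne_eq, Fin.ext_iff, Fin.val_zero] at q1 q2 q3 q4 q5 q6 ⊢
          simp only [if_neg q1, if_neg q2, if_neg q3]
          cases ha : a j <;> cases hb : b j <;> grind)
      have h3 := h.2 ⟨3, by omega⟩ ⟨1, by omega⟩ ⟨2, by omega⟩ (by simp [Fin.ext_iff])
        (by simp [Fin.ext_iff]) (by simp [Fin.ext_iff]) (by simp [Fin.ext_iff])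
        (by simp [Fin.ext_iff]) (by simp [Fin.ext_iff])
      have hor := mono a (fun j => a j || b j) (by intro j h; simp [h]) hFa
      simpa [hFa, hFb, hor] using h3
    by_cases hne : ∃ x, F x = true
    · obtain ⟨a, ha, hmin⟩ : ∃ a, F a = true ∧ ∀ x, F x = true → ∀ j, a j = true → x j = true := by
        obtain ⟨a, ha⟩ := Set.Finite.exists_minimal (Set.toFinite {x | F x = true}) hne
        refine ⟨a, ha.1, fun x hx j hj => ?_⟩
        have h2 := ha.2 (meet a x ha.1 hx) (fun j => by
          show (a j && x j) ≤ a j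
          cases a j <;> cases x j <;> decide) j
        revert h2
        show a j ≤ (a j && x j) → _
        rw [hj]
        cases x j <;> decide
      have := conj_mem C hC hG n (Finset.univ.filter (fun i => a i = true))
      refine mem_congr ?_ this
      funext x
      symm
      rw [hF]
      congr 1
      rw [Bool.eq_iff_iff]
      simp only [Finset.mem_filter, Finset.mem_univ, true_and, decide_eq_true_eq]
      exact ⟨fun h => hmin x h, fun h => mono a x h ha⟩
    · have : (⟨n, f⟩ : PF Bool) = constPF false n := by
        have : f = fun _ => some false := by
          funext x
          rw [hF]
          cases h : F x
          · rfl
          · exact (hne ⟨x, h⟩).elim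
        rw [this]; rfl
      rw [this]
      exact hG (Or.inr ⟨n, Or.inl rfl⟩)
  · exact Set.sInter_subset_of_mem ⟨isClone_PolSet _, gens_sub m hm⟩

end StrongPartial
end

section
/- Let N̂ := {n ∈ ℕ : n ≥ 3}, n ∈ N̂, and M ⊆ N̂ \ {n}. Then pPol R^Λ_n does not contain the intersection ⋂_{m ∈ M} pPol R^Λ_m (where the empty intersection is the set of all partial functions on 𝟚); i.e. there exists a partial function preserving R^Λ_m for every m ∈ M but not preserving R^Λ_n. -/
namespace StrongPartial

variable {A : Type}

theorem RLam_key (n m : ℕ) (hn : 3 ≤ n) (hm : 3 ≤ m) (hmn : m ≠ n)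
    (φ : Fin (m+1) → Fin (n+1))
    (H : ∀ x ∈ RLam n, (fun i => x (φ i)) ∈ RLam m) (v : Fin (m+1) → Bool)
    (hv : ∀ i, v i = true ↔ φ i ≠ 0) : v ∈ RLam m := by
  have hpair : ∀ k : Fin (n+1), k ≠ 0 →
      (fun t : Fin (n+1) => decide (t = 0 ∨ t = k)) ∈ RLam n := by
    intro k hk
    refine ⟨by simp, ?_⟩
    intro i j1 j2 hi h1 h2 hi1 hi2 h12
    simp only [decide_eq_true_eq, decide_eq_false_iff_not]
    grind
  have hzero : ∀ (p : Fin (n+1) → Prop) [DecidablePred p], ¬ p 0 → (∃ t, t ≠ 0 ∧ ¬ p t) →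
      (fun t : Fin (n+1) => decide (p t)) ∈ RLam n := by
    intro p _ h0 ⟨t, ht, hpt⟩
    refine ⟨Or.inr ⟨t, ht, by simpa using hpt⟩, ?_⟩
    intro i j1 j2 _ _ _ _ _ _
    right; left; simpa using h0
  constructor
  · by_contra hcon
    push Not at hcon
    obtain ⟨h0, h1⟩ := hcon
    have p0 : φ 0 = 0 := by
      by_contra h
      exact h0 ((hv 0).2 h)
    have p1 : ∀ j, j ≠ 0 → φ j ≠ 0 := by
      intro j hj
      apply (hv j).1
      simpa using h1 j hj
    have inj : Function.Injective φ := by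
      intro i j hij
      by_contra hne
      have hi : i ≠ 0 := by
        rintro rfl
        exact p1 j (Ne.symm hne) (by rw [← hij, p0])
      have hj : j ≠ 0 := by
        rintro rfl
        exact p1 i hne (by rw [hij, p0])
      have hall : ∀ l, l ≠ 0 → φ l = φ i := by
        intro l hl
        by_cases hli : l = i
        · rw [hli]
        by_cases hlj : l = j
        · rw [hlj, hij]
        have := (H _ (hpair (φ i) (p1 i hi))).2 l i j hl hi hj hli hlj hne
        simp only [decide_eq_true_eq, decide_eq_false_iff_not] at this
        have := p1 l hl
        grind
      have hex : ∃ t : Fin (n+1), t ≠ 0 ∧ ¬ t = φ i := by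
        by_cases h : φ i = ⟨1, by omega⟩
        · exact ⟨⟨2, by omega⟩, by simp [Fin.ext_iff], by simp [h]⟩
        · exact ⟨⟨1, by omega⟩, by simp [Fin.ext_iff], fun h' => h h'.symm⟩
      have := (H _ (hzero (fun t => t = φ i) (fun h => p1 i hi h.symm) hex)).1
      simp only [decide_eq_true_eq, decide_eq_false_iff_not] at this
      rcases this with h | ⟨l, hl, h⟩
      · exact p1 i hi (by rw [← h, p0])
      · exact h (hall l hl)
    have hns : ¬ Function.Surjective φ := by
      intro hs
      have := Fintype.card_of_bijective ⟨inj, hs⟩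
      simp at this
      exact hmn this
    rw [Function.Surjective] at hns
    push Not at hns
    obtain ⟨t, ht⟩ := hns
    have ht0 : t ≠ 0 := fun h => ht 0 (by rw [p0, h])
    have := (H _ (hzero (fun s => s ≠ 0 ∧ s ≠ t) (by simp) ⟨t, ht0, by simp⟩)).1
    simp only [decide_eq_true_eq, decide_eq_false_iff_not] at this
    rcases this with h | ⟨l, hl, h⟩
    · exact h.1 p0
    · exact h ⟨p1 l hl, ht l⟩
  · intro i j1 j2 hi hj1 hj2 hi1 hi2 h12
    by_contra hcon
    simp only [not_or, Bool.not_eq_false, hv, not_not] at hcon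
    obtain ⟨qi, q0, q1, q2⟩ := hcon
    by_cases hex : ∃ t : Fin (n+1), t ≠ 0 ∧ ¬ (t = φ 0 ∨ t = φ j1 ∨ t = φ j2)
    · have := (H _ (hzero (fun t => t = φ 0 ∨ t = φ j1 ∨ t = φ j2) (by grind) hex)).2
        i j1 j2 hi hj1 hj2 hi1 hi2 h12
      simp only [decide_eq_true_eq, decide_eq_false_iff_not] at this
      grind
    · push Not at hex
      have hsub : (Finset.univ : Finset (Fin (n+1))) ⊆ {0, φ 0, φ j1, φ j2} := by
        intro t _
        simp only [Finset.mem_insert, Finset.mem_singleton]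
        by_cases h : t = 0
        · exact Or.inl h
        · exact Or.inr (hex t h)
      have hc := Finset.card_le_card hsub
      simp only [Finset.card_univ, Fintype.card_fin] at hc
      have h4 := Finset.card_le_four (a := (0 : Fin (n+1))) (b := φ 0) (c := φ j1) (d := φ j2)
      have hn3 : n = 3 := by omega
      have d01 : φ 0 ≠ φ j1 := by
        intro h
        rw [← h, Finset.insert_eq_of_mem (a := φ 0) (by simp)] at hc
        have := Finset.card_le_three (a := (0 : Fin (n+1))) (b := φ 0) (c := φ j2)
        omega
      have d02 : φ 0 ≠ φ j2 := by
        intro h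
        rw [← h, Finset.insert_eq_of_mem (a := φ 0) (by simp)] at hc
        have := Finset.card_le_three (a := (0 : Fin (n+1))) (b := φ j1) (c := φ 0)
        omega
      have d12 : φ j1 ≠ φ j2 := by
        intro h
        rw [← h, Finset.insert_eq_of_mem (a := φ j1) (by simp)] at hc
        have := Finset.card_le_three (a := (0 : Fin (n+1))) (b := φ 0) (c := φ j1)
        omega
      have hl : ∃ l : Fin (m+1), l ∉ ({0, i, j1, j2} : Finset (Fin (m+1))) := by
        by_contra h
        push Not at h
        have := Finset.card_le_card (fun t _ => h t :
          (Finset.univ : Finset (Fin (m+1))) ⊆ {0, i, j1, j2})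
        have h4 := Finset.card_le_four (a := (0 : Fin (m+1))) (b := i) (c := j1) (d := j2)
        simp only [Finset.card_univ, Fintype.card_fin] at this
        omega
      obtain ⟨l, hl⟩ := hl
      simp only [Finset.mem_insert, Finset.mem_singleton, not_or] at hl
      obtain ⟨l0, li, l1, l2⟩ := hl
      have A := (H _ (hpair (φ 0) q0)).2 j1 i l hj1 hi l0 (Ne.symm hi1) (Ne.symm l1) (Ne.symm li)
      simp only [decide_eq_true_eq, decide_eq_false_iff_not] at A
      have B1 := (H _ (hzero (fun t => t = φ 0 ∨ t = φ j1) (by grind) ⟨φ j2, by grind⟩)).2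
        i j1 l hi hj1 l0 hi1 (Ne.symm li) (Ne.symm l1)
      simp only [decide_eq_true_eq, decide_eq_false_iff_not] at B1
      have B2 := (H _ (hzero (fun t => t = φ 0 ∨ t = φ j2) (by grind) ⟨φ j1, by grind⟩)).2
        i j2 l hi hj2 l0 hi2 (Ne.symm li) (Ne.symm l2)
      simp only [decide_eq_true_eq, decide_eq_false_iff_not] at B2
      have := hex (φ l)
      grind

theorem RLam_nonconstructible (n : ℕ) (hn : 3 ≤ n)
    (M : Set ℕ) (hM : ∀ m ∈ M, 3 ≤ m ∧ m ≠ n) :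
    ¬ ({f : PF Bool | ∀ m ∈ M, Preserves f (RLam m)} ⊆ pPolSet (RLam n)) := by
  classical
  intro hsub
  have hne : (fun _ => true) ∈ RLam n := ⟨Or.inl rfl, fun _ _ _ _ _ _ _ _ _ => Or.inl rfl⟩
  haveI : Nonempty (RLam n) := ⟨⟨_, hne⟩⟩
  obtain ⟨K, hK⟩ : ∃ K, Fintype.card (RLam n) = K + 1 :=
    Nat.exists_eq_succ_of_ne_zero Fintype.card_ne_zero
  let e := Fintype.equivFinOfCardEq hK
  let r : Fin (n+1) → Fin (K+1) → Bool := fun i j => (e.symm j).1 i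
  have hr0 : ∀ i, i ≠ 0 → r i ≠ r 0 := by
    intro i hi h
    have hx : (fun t : Fin (n+1) => decide (t = 0)) ∈ RLam n := by
      refine ⟨by simp, ?_⟩
      intro i j1 j2 _ h1 _ _ _ _
      right; right; left; simpa using h1
    have := congrFun h (e ⟨_, hx⟩)
    simp [r] at this
    exact hi this
  let f : PF Bool := ⟨K, fun x => if x = r 0 then some false else
    if ∃ i, x = r i then some true else none⟩
  have hf : f ∈ {f : PF Bool | ∀ m ∈ M, Preserves f (RLam m)} := by
    intro m hm Mt v hcol hval
    obtain ⟨hm3, hmn⟩ := hM m hm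
    have hφ : ∀ i, ∃ k, Mt i = r k ∧ (v i = true ↔ k ≠ 0) := by
      intro i
      have h := hval i
      simp only [f] at h
      split_ifs at h with h1 h2
      · refine ⟨0, h1, ?_⟩
        simp only [Option.some.injEq] at h
        simp [← h]
      · obtain ⟨k, hk⟩ := h2
        refine ⟨k, hk, ?_⟩
        simp only [Option.some.injEq] at h
        simp only [← h, true_iff]
        rintro rfl
        exact h1 hk
    choose φ h1 h2 using hφ
    refine RLam_key n m hn hm3 hmn φ ?_ v h2
    intro x hx
    have := hcol (e ⟨x, hx⟩)
    simpa [h1, r] using this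
  have hbad := hsub hf r (fun i => decide (i ≠ 0)) (fun j => (e.symm j).2) (by
    intro i
    by_cases h : i = 0
    · simp [f, h]
    · simp [f, h, hr0 i h])
  rcases hbad.1 with h | ⟨j, hj, h⟩
  · simp at h
  · simp at h
    exact hj h

end StrongPartial
end
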